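/- arXiv:1209.0502 — 10 statements merged into one kernel-verified Lean document; each statement's English description precedes it below -/
import Mathlib

section
/- Let P be a prime ideal of the G-group H and x ∈ H. If G(n)(x) ≤ P for some n ≥ 1, then x ∈ P. In particular, every nilpotent element of H lies in P, and hence the normal subgroup Nil(H) of H generated by the nilpotent elements of H is contained in every prime ideal of H. -/
/-- `G(x)`: the subgroup of `H` generated by the conjugates `φ g * x * (φ g)⁻¹`. -/
def conjClosure {G H : Type*} [Group G] [Group H] (φ : G →* H) (x : H) : Subgroup H :=
  Subgroup.closure {z : H | ∃ g : G, z = φ g * x * (φ g)⁻¹}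

/-- `x` is a divisor of zero in the `G`-group `H`. -/
def IsZeroDivisor {G H : Type*} [Group G] [Group H] (φ : G →* H) (x : H) : Prop :=
  x ≠ 1 ∧ ∃ y : H, y ≠ 1 ∧ ⁅conjClosure φ x, conjClosure φ y⁆ = (⊥ : Subgroup H)

/-- An ideal of the `G`-group `H`: a normal subgroup meeting `φ(G)` trivially. -/
def IsIdeal {G H : Type*} [Group G] [Group H] (φ : G →* H) (I : Subgroup H) : Prop :=
  I.Normal ∧ I ⊓ φ.range = ⊥

/-- A prime ideal of the `G`-group `H`. -/
def IsPrimeIdeal {G H : Type*} [Group G] [Group H] (φ : G →* H) (P : Subgroup H) : Prop :=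
  IsIdeal φ P ∧ P ≠ ⊤ ∧
    ∀ x y : H, ⁅conjClosure φ x, conjClosure φ y⁆ ≤ P ↔ x ∈ P ∨ y ∈ P

/-- `V(I)`: the set of prime ideals containing the normal subgroup `I`. -/
def V {G H : Type*} [Group G] [Group H] (φ : G →* H) (I : Subgroup H) : Set (Subgroup H) :=
  {P : Subgroup H | IsPrimeIdeal φ P ∧ I ≤ P}

/-- The iterated commutator subgroups: `Gn φ x 0 = G(x)`,
`Gn φ x n = G(n+1)(x) = ⁅G(x), G(n)(x)⁆`. -/
def Gn {G H : Type*} [Group G] [Group H] (φ : G →* H) (x : H) : ℕ → Subgroup H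
  | 0 => conjClosure φ x
  | (n + 1) => ⁅conjClosure φ x, Gn φ x n⁆

/-- `x` is a nilpotent element of the `G`-group `H`. -/
def IsNilpotentElt {G H : Type*} [Group G] [Group H] (φ : G →* H) (x : H) : Prop :=
  ∃ n : ℕ, Gn φ x n = ⊥

theorem conjClosure_map_le {G H : Type*} [Group G] [Group H] (φ : G →* H) (x : H) (g : G) :
    (conjClosure φ x).map (MulAut.conj (φ g)).toMonoidHom ≤ conjClosure φ x := by
  unfold conjClosure
  rw [MonoidHom.map_closure, Subgroup.closure_le]
  rintro _ ⟨_, ⟨k, rfl⟩, rfl⟩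
  apply Subgroup.subset_closure
  refine ⟨g * k, ?_⟩
  simp [mul_assoc]

theorem Gn_map_le {G H : Type*} [Group G] [Group H] (φ : G →* H) (x : H) (g : G) (n : ℕ) :
    (Gn φ x n).map (MulAut.conj (φ g)).toMonoidHom ≤ Gn φ x n := by
  induction n with
  | zero => exact conjClosure_map_le φ x g
  | succ n ih =>
    simp only [Gn]
    rw [Subgroup.map_commutator]
    exact Subgroup.commutator_mono (conjClosure_map_le φ x g) ih

theorem conjClosure_le_Gn {G H : Type*} [Group G] [Group H] (φ : G →* H) (x y : H) (n : ℕ)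
    (hy : y ∈ Gn φ x n) : conjClosure φ y ≤ Gn φ x n := by
  unfold conjClosure
  rw [Subgroup.closure_le]
  rintro _ ⟨g, rfl⟩
  exact Gn_map_le φ x g n ⟨y, hy, by simp⟩

theorem mem_of_Gn_le {G H : Type*} [Group G] [Group H] (φ : G →* H)
    (P : Subgroup H) (hP : IsPrimeIdeal φ P) (x : H) (n : ℕ) (h : Gn φ x n ≤ P) : x ∈ P := by
  induction n with
  | zero => exact h (Subgroup.subset_closure ⟨1, by simp⟩)
  | succ n ih =>
    by_contra hx
    refine hx (ih fun y hy => ?_)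
    have := (hP.2.2 x y).1
      ((Subgroup.commutator_mono le_rfl (conjClosure_le_Gn φ x y n hy)).trans h)
    exact this.resolve_left hx

/-- If some iterated commutator subgroup `G(n)(x)` (`n ≥ 1`, i.e. `Gn φ x m` for some
`m ≥ 0`) is contained in a prime ideal `P`, then `x ∈ P`; in particular the normal
subgroup generated by the nilpotent elements is contained in every prime ideal. -/
theorem statement4 {G H : Type*} [Group G] [Group H] (φ : G →* H)
    (hφ : Function.Injective φ) (P : Subgroup H) (hP : IsPrimeIdeal φ P) :
    (∀ x : H, ∀ n : ℕ, Gn φ x n ≤ P → x ∈ P) ∧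
      Subgroup.normalClosure {x : H | IsNilpotentElt φ x} ≤ P := by
  refine ⟨fun x n h => mem_of_Gn_le φ P hP x n h, ?_⟩
  have := hP.1.1
  refine Subgroup.normalClosure_le_normal ?_
  rintro x ⟨n, hn⟩
  exact mem_of_Gn_le φ P hP x n (hn ▸ bot_le)
end

section
/- Let H and H' be G-groups with structure maps φ_H : G → H and φ_{H'} : G → H', and let f : H → H' be a group homomorphism with f ∘ φ_H = φ_{H'}. Then for every prime ideal P of H', the preimage f⁻¹(P) is a prime ideal of H. -/
theorem map_conjClosure_aux {G H H' : Type*} [Group G] [Group H] [Group H']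
    (φH : G →* H) (f : H →* H') (x : H) :
    (conjClosure φH x).map f = conjClosure (f.comp φH) (f x) := by
  unfold conjClosure
  rw [MonoidHom.map_closure]
  congr 1
  ext z
  constructor
  · rintro ⟨_, ⟨g, rfl⟩, rfl⟩
    exact ⟨g, by simp⟩
  · rintro ⟨g, rfl⟩
    exact ⟨_, ⟨g, rfl⟩, by simp⟩

/-- The preimage of a prime ideal under a `G`-morphism is a prime ideal. -/
theorem statement7 {G H H' : Type*} [Group G] [Group H] [Group H']
    (φH : G →* H) (φH' : G →* H') (hφH : Function.Injective φH)
    (hφH' : Function.Injective φH') (f : H →* H') (hf : f.comp φH = φH')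
    (P : Subgroup H') (hP : IsPrimeIdeal φH' P) :
    IsPrimeIdeal φH (P.comap f) := by
  subst hf
  obtain ⟨⟨hN, hI⟩, hT, hp⟩ := hP
  have key : ∀ g : G, f (φH g) ∈ P → g = 1 := by
    intro g hg
    have h1 : f (φH g) ∈ P ⊓ (f.comp φH).range := ⟨hg, g, rfl⟩
    rw [hI, Subgroup.mem_bot] at h1
    apply hφH'
    simpa using h1
  refine ⟨⟨hN.comap f, ?_⟩, ?_, ?_⟩
  · rw [eq_bot_iff]
    rintro _ ⟨hx, g, rfl⟩
    rw [key g hx]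
    simp
  · intro htop
    have hG : ∀ g : G, g = 1 := fun g => key g (by
      have h1 : φH g ∈ P.comap f := by rw [htop]; trivial
      exact h1)
    apply hT
    rw [eq_top_iff]
    intro x _
    have hc : ⁅conjClosure (f.comp φH) x, conjClosure (f.comp φH) x⁆ ≤ P := by
      have hz : conjClosure (f.comp φH) x ≤ Subgroup.zpowers x := by
        unfold conjClosure
        rw [Subgroup.closure_le]
        rintro _ ⟨g, rfl⟩
        rw [hG g]
        simp
      rw [Subgroup.commutator_le]
      intro a ha b hb
      obtain ⟨m, rfl⟩ := hz ha
      obtain ⟨n, rfl⟩ := hz hb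
      have h1 := commutatorElement_eq_one_iff_commute.2 (Commute.zpow_zpow_self x m n)
      refine (congrArg (· ∈ P) h1).mpr ?_
      exact P.one_mem
    simpa using (hp x x).1 hc
  · intro x y
    rw [← Subgroup.map_le_iff_le_comap, Subgroup.map_commutator, map_conjClosure_aux,
      map_conjClosure_aux, hp]
    rfl
end

section
/- Let F be a free group on a set with at least two elements, and let I and J be normal subgroups of F such that the commutator subgroup ⁅I, J⁆ is trivial. Then I is trivial or J is trivial. -/
theorem exists_letter {S : Type*} [Nontrivial S] (u v t : S × Bool) :
    ∃ c : S × Bool, c ≠ u ∧ c ≠ v ∧ c ≠ t := by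
  classical
  obtain ⟨a, b, hab⟩ := exists_pair_ne S
  have h4 : ({(a, true), (a, false), (b, true), (b, false)} : Finset (S × Bool)).card = 4 := by
    simp [Finset.card_insert_of_notMem, hab]
  have h3 : ({u, v, t} : Finset (S × Bool)).card ≤ 3 := Finset.card_le_three
  obtain ⟨c, -, hc⟩ := Finset.exists_mem_notMem_of_card_lt_card
    (show ({u, v, t} : Finset (S × Bool)).card <
      ({(a, true), (a, false), (b, true), (b, false)} : Finset (S × Bool)).card by omega)
  simp only [Finset.mem_insert, Finset.mem_singleton, not_or] at hc
  exact ⟨c, hc⟩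

theorem letter_ok {S : Type*} (c p : S × Bool) (h : c ≠ (p.1, !p.2)) :
    c.1 = p.1 → c.2 = p.2 := by
  intro h1
  by_contra h2
  apply h
  ext
  · exact h1
  · exact Bool.eq_not_of_ne h2

theorem reduced_conj {S : Type*} (w : List (S × Bool)) (hw : FreeGroup.IsReduced w) (hne : w ≠ [])
    (c : S × Bool) (h1 : c ≠ ((w.head hne).1, !(w.head hne).2)) (h2 : c ≠ w.getLast hne) :
    FreeGroup.IsReduced (c :: (w ++ [(c.1, !c.2)])) := by
  unfold FreeGroup.IsReduced at *
  rw [List.isChain_cons, List.isChain_append]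
  refine ⟨?_, hw, by simp, ?_⟩
  · intro y hy
    rw [List.head?_append_of_ne_nil _ hne, List.head?_eq_some_head hne] at hy
    simp only [Option.mem_def, Option.some.injEq] at hy
    subst hy
    exact letter_ok _ _ h1
  · intro x hx y hy
    rw [List.getLast?_eq_some_getLast hne] at hx
    simp only [Option.mem_def, Option.some.injEq, List.head?_cons] at hx hy
    subst hx hy
    refine letter_ok _ _ ?_
    simpa using h2.symm

theorem mk_conj {S : Type*} (w : List (S × Bool)) (c : S × Bool) :
    FreeGroup.mk (c :: (w ++ [(c.1, !c.2)])) =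
      FreeGroup.mk [c] * FreeGroup.mk w * (FreeGroup.mk [c])⁻¹ := by
  simp [FreeGroup.inv_mk, FreeGroup.invRev, FreeGroup.mul_mk]

theorem exists_conj {S : Type*} [Nontrivial S] (N : Subgroup (FreeGroup S)) (hN : N.Normal)
    (hne : N ≠ ⊥) (a : S) : ∃ w : List (S × Bool),
      FreeGroup.IsReduced ((a, true) :: (w ++ [(a, false)])) ∧
      FreeGroup.mk ((a, true) :: (w ++ [(a, false)])) ∈ N := by
  classical
  obtain ⟨⟨x, hx⟩, hx0⟩ := Subgroup.ne_bot_iff_exists_ne_one.1 hne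
  have hx1 : x ≠ 1 := fun h' => hx0 (Subtype.ext h')
  have hw : x.toWord ≠ [] := fun h => hx1 (FreeGroup.toWord_eq_nil_iff.1 h)
  obtain ⟨c, h1, h2, h3⟩ := exists_letter
    ((x.toWord.head hw).1, !(x.toWord.head hw).2) (x.toWord.getLast hw) (a, false)
  have hr := reduced_conj x.toWord FreeGroup.isReduced_toWord hw c h1 h2
  refine ⟨c :: (x.toWord ++ [(c.1, !c.2)]), ?_, ?_⟩
  · refine reduced_conj _ hr (by simp) (a, true) ?_ ?_
    · rintro h
      apply h3
      simp only [List.head_cons, Prod.mk.injEq] at h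
      ext
      · exact h.1.symm
      · simpa using h.2
    · rintro h
      apply h3
      simp [Prod.ext_iff] at h
      ext
      · exact h.1.symm
      · simpa using h.2
  · have := mk_conj (c :: (x.toWord ++ [(c.1, !c.2)])) (a, true)
    simp only [Bool.not_true] at this
    rw [this, mk_conj, FreeGroup.mk_toWord]
    exact hN.conj_mem _ (hN.conj_mem _ hx _) _

theorem reduced_append {S : Type*} (u v : List (S × Bool)) (a b : S) (hab : a ≠ b)
    (hu : FreeGroup.IsReduced ((a, true) :: (u ++ [(a, false)])))
    (hv : FreeGroup.IsReduced ((b, true) :: (v ++ [(b, false)]))) :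
    FreeGroup.IsReduced (((a, true) :: (u ++ [(a, false)])) ++ ((b, true) :: (v ++ [(b, false)])))
    := by
  unfold FreeGroup.IsReduced at *
  rw [List.isChain_append]
  refine ⟨hu, hv, ?_⟩
  intro x hx y hy
  rw [← List.cons_append, List.getLast?_concat] at hx
  simp only [Option.mem_def, Option.some.injEq, List.head?_cons] at hx hy
  subst hx hy
  intro h
  exact absurd h hab

/-- In a free group on at least two generators, two normal subgroups that commute
elementwise cannot both be nontrivial. -/
theorem statement8 {S : Type*} [Nontrivial S]
    (I J : Subgroup (FreeGroup S)) (hI : I.Normal) (hJ : J.Normal)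
    (h : ⁅I, J⁆ = (⊥ : Subgroup (FreeGroup S))) :
    I = ⊥ ∨ J = ⊥ := by
  classical
  by_contra hcon
  push Not at hcon
  obtain ⟨a, b, hab⟩ := exists_pair_ne S
  obtain ⟨u, hu, hui⟩ := exists_conj I hI hcon.1 a
  obtain ⟨v, hv, hvj⟩ := exists_conj J hJ hcon.2 b
  have hc := Subgroup.mem_centralizer_iff.1
    ((Subgroup.commutator_eq_bot_iff_le_centralizer.1 h) hui) _ hvj
  rw [FreeGroup.mul_mk, FreeGroup.mul_mk] at hc
  have hc' := FreeGroup.reduce.sound hc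
  rw [(reduced_append v u b a hab.symm hv hu).reduce_eq,
    (reduced_append u v a b hab hu hv).reduce_eq] at hc'
  simp only [List.cons_append, List.cons.injEq, Prod.mk.injEq] at hc'
  exact hab hc'.1.1.symm
end

section
/- Let H be a G-group. For all normal subgroups I and J of H, V(⁅I, J⁆) = V(I ∩ J); equivalently, every prime ideal of H containing ⁅I, J⁆ contains I ∩ J. -/
/-- `V(⁅I, J⁆) = V(I ∩ J)` for normal subgroups `I`, `J` of a `G`-group. -/
theorem statement9 {G H : Type*} [Group G] [Group H] (φ : G →* H)
    (hφ : Function.Injective φ)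
    (I J : Subgroup H) (hI : I.Normal) (hJ : J.Normal) :
    V φ ⁅I, J⁆ = V φ (I ⊓ J) := by
  have key : ∀ (K : Subgroup H), K.Normal → ∀ x ∈ K, conjClosure φ x ≤ K := by
    intro K hK x hx
    unfold conjClosure
    rw [Subgroup.closure_le]
    rintro z ⟨g, rfl⟩
    exact hK.conj_mem x hx (φ g)
  ext P
  constructor
  · rintro ⟨hP, h⟩
    refine ⟨hP, ?_⟩
    intro x hx
    have h2 := (hP.2.2 x x).1
      ((Subgroup.commutator_mono (key I hI x hx.1) (key J hJ x hx.2)).trans h)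
    exact h2.elim id id
  · rintro ⟨hP, h⟩
    exact ⟨hP, (Subgroup.commutator_le_inf I J).trans h⟩
end

section
/- Let I be an ideal of the G-group H which is a radical ideal, i.e. V(I) is nonempty and I equals the intersection of all prime ideals of H containing I. If V(I) is irreducible — that is, for all normal subgroups J and K of H, V(I) ⊆ V(J) ∪ V(K) implies V(I) ⊆ V(J) or V(I) ⊆ V(K) — then I is a prime ideal of H. -/
/-- A radical ideal with irreducible `V(I)` is prime. -/
theorem statement13 {G H : Type*} [Group G] [Group H] (φ : G →* H)
    (hφ : Function.Injective φ) (I : Subgroup H) (hI : IsIdeal φ I)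
    (hne : (V φ I).Nonempty)
    (hrad : I = sInf {P : Subgroup H | IsPrimeIdeal φ P ∧ I ≤ P})
    (hirr : ∀ J K : Subgroup H, J.Normal → K.Normal →
      V φ I ⊆ V φ J ∪ V φ K → V φ I ⊆ V φ J ∨ V φ I ⊆ V φ K) :
    IsPrimeIdeal φ I := by
  have mem : ∀ z : H, (∀ P ∈ V φ I, z ∈ P) → z ∈ I := by
    intro z hz
    rw [hrad, Subgroup.mem_sInf]
    exact fun P hP => hz P hP
  refine ⟨hI, ?_, ?_⟩
  · rintro rfl
    obtain ⟨P, hP, hle⟩ := hne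
    exact hP.2.1 (top_le_iff.mp hle)
  intro x y
  constructor
  · intro h
    have key := hirr (Subgroup.normalClosure {x}) (Subgroup.normalClosure {y})
      inferInstance inferInstance (by
        rintro P ⟨hP, hle⟩
        haveI := hP.1.1
        rcases (hP.2.2 x y).1 (h.trans hle) with hx | hy
        · exact Or.inl ⟨hP, Subgroup.normalClosure_le_normal (by simpa using hx)⟩
        · exact Or.inr ⟨hP, Subgroup.normalClosure_le_normal (by simpa using hy)⟩)
    rcases key with k | k
    · exact Or.inl (mem x fun P hP =>
        (k hP).2 (Subgroup.subset_normalClosure (Set.mem_singleton x)))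
    · exact Or.inr (mem y fun P hP =>
        (k hP).2 (Subgroup.subset_normalClosure (Set.mem_singleton y)))
  · intro h z hz
    exact mem z fun P hP =>
      (hP.1.2.2 x y).2 (h.imp (fun hx => hP.2 hx) (fun hy => hP.2 hy)) hz
end

section
/- Let H be a G-group such that every descending sequence V(I₁) ⊇ V(I₂) ⊇ … of closed sets (where each I_k is a normal subgroup of H) is eventually constant. Then the radical Rad_G(H), defined as the intersection of all prime ideals of H, is the intersection of finitely many prime ideals: there exist finitely many prime ideals P₁, …, P_n of H with Rad_G(H) = P₁ ∩ … ∩ P_n. -/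
theorem finite_decomp_aux {G H : Type*} [Group G] [Group H] (φ : G →* H)
    (hnoeth : ∀ I : ℕ → Subgroup H, (∀ n, (I n).Normal) →
      (∀ n, V φ (I (n + 1)) ⊆ V φ (I n)) → ∃ N : ℕ, ∀ n, N ≤ n → V φ (I n) = V φ (I N))
    (I : {I : Subgroup H // I.Normal}) :
    ∃ s : Finset (Subgroup H), (∀ P ∈ s, IsPrimeIdeal φ P) ∧
      sInf (V φ I.1) = sInf (s : Set (Subgroup H)) := by
  classical
  have wf : WellFounded (fun A B : {I : Subgroup H // I.Normal} => V φ A.1 ⊂ V φ B.1) := by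
    haveI : Std.Irrefl (fun A B : {I : Subgroup H // I.Normal} => V φ A.1 ⊂ V φ B.1) :=
      ⟨fun A h => (ssubset_irrefl _ h)⟩
    haveI : IsTrans _ (fun A B : {I : Subgroup H // I.Normal} => V φ A.1 ⊂ V φ B.1) :=
      ⟨fun A B C h h2 => h.trans h2⟩
    haveI : IsStrictOrder _ (fun A B : {I : Subgroup H // I.Normal} => V φ A.1 ⊂ V φ B.1) := {}
    rw [RelEmbedding.wellFounded_iff_isEmpty]
    refine ⟨fun f => ?_⟩
    have hf : ∀ n, V φ (f (n + 1)).1 ⊂ V φ (f n).1 := fun n =>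
      f.map_rel_iff.2 (Nat.lt_succ_self n)
    obtain ⟨N, hN⟩ := hnoeth (fun n => (f n).1) (fun n => (f n).2) (fun n => (hf n).subset)
    exact (hf N).ne (hN (N + 1) (Nat.le_succ N))
  induction I using wf.induction with
  | _ I ih =>
  obtain ⟨I, hI⟩ := I
  simp only at ih ⊢
  by_cases hne : (V φ I).Nonempty
  swap
  · refine ⟨∅, by simp, ?_⟩
    rw [Set.not_nonempty_iff_eq_empty.1 hne]; simp
  by_cases hp : IsPrimeIdeal φ (sInf (V φ I))
  · exact ⟨{sInf (V φ I)}, by simpa using hp, by simp⟩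
  obtain ⟨P, hP⟩ := hne
  have hJn : (sInf (V φ I)).Normal := by
    refine ⟨fun n hn g => ?_⟩
    rw [Subgroup.mem_sInf] at hn ⊢
    exact fun Q hQ => hQ.1.1.1.conj_mem _ (hn Q hQ) g
  have hmem : ∀ (Q : Subgroup H), Q.Normal → ∀ x ∈ Q, conjClosure φ x ≤ Q := by
    intro Q hQ x hx
    refine (Subgroup.closure_le _).2 ?_
    rintro _ ⟨g, rfl⟩
    exact hQ.conj_mem _ hx _
  have hex : ∃ x y : H, ⁅conjClosure φ x, conjClosure φ y⁆ ≤ sInf (V φ I) ∧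
      x ∉ sInf (V φ I) ∧ y ∉ sInf (V φ I) := by
    by_contra hcon
    push Not at hcon
    refine hp ⟨⟨hJn, ?_⟩, ?_, fun x y => ⟨fun h => ?_, ?_⟩⟩
    · rw [eq_bot_iff, ← hP.1.1.2]
      exact inf_le_inf_right _ (sInf_le hP)
    · intro h
      exact hP.1.2.1 (top_le_iff.1 (h ▸ sInf_le hP))
    · by_cases hx : x ∈ sInf (V φ I)
      · exact Or.inl hx
      · exact Or.inr (hcon x y h hx)
    · rintro (h | h)
      · exact (Subgroup.commutator_mono (hmem _ hJn x h) le_rfl).trans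
          (Subgroup.commutator_le_left _ _ |>.trans le_rfl)
      · exact (Subgroup.commutator_mono le_rfl (hmem _ hJn y h)).trans
          (Subgroup.commutator_le_right _ _)
  obtain ⟨x, y, hxy, hx, hy⟩ := hex
  have hV : ∀ (z : H) (Q : Subgroup H),
      Q ∈ V φ (I ⊔ Subgroup.normalClosure {z}) ↔ Q ∈ V φ I ∧ z ∈ Q := by
    intro z Q
    constructor
    · rintro ⟨h1, h2⟩
      exact ⟨⟨h1, le_sup_left.trans h2⟩,
        h2 (le_sup_right (a := I) (Subgroup.subset_normalClosure (Set.mem_singleton z)))⟩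
    · rintro ⟨⟨h1, h2⟩, h3⟩
      haveI := h1.1.1
      exact ⟨h1, sup_le h2 (Subgroup.normalClosure_le_normal (by simpa using h3))⟩
  have key : ∀ z : H, z ∉ sInf (V φ I) → ∃ s : Finset (Subgroup H),
      (∀ P ∈ s, IsPrimeIdeal φ P) ∧
      sInf (V φ (I ⊔ Subgroup.normalClosure {z})) = sInf (s : Set (Subgroup H)) := by
    intro z hz
    refine ih ⟨I ⊔ Subgroup.normalClosure {z}, inferInstance⟩ ?_
    refine (Set.ssubset_iff_subset_ne).2 ⟨fun Q hQ => ((hV z Q).1 hQ).1, fun h => hz ?_⟩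
    rw [Subgroup.mem_sInf]
    intro Q hQ
    rw [← h] at hQ
    exact ((hV z Q).1 hQ).2
  obtain ⟨s, hs, hs'⟩ := key x hx
  obtain ⟨t, ht, ht'⟩ := key y hy
  refine ⟨s ∪ t, ?_, ?_⟩
  · intro Q hQ
    rcases Finset.mem_union.1 hQ with h | h
    exacts [hs Q h, ht Q h]
  · rw [Finset.coe_union, sInf_union, ← hs', ← ht', ← sInf_union]
    congr 1
    ext Q
    rw [Set.mem_union, hV, hV]
    constructor
    · intro hQ
      rcases (hQ.1.2.2 x y).1 (hxy.trans (sInf_le hQ)) with h | h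
      exacts [Or.inl ⟨hQ, h⟩, Or.inr ⟨hQ, h⟩]
    · rintro (h | h) <;> exact h.1

/-- If every descending chain of closed sets `V(Iₖ)` stabilizes, then the radical
(the intersection of all prime ideals) is an intersection of finitely many primes. -/
theorem statement15 {G H : Type*} [Group G] [Group H] (φ : G →* H)
    (hφ : Function.Injective φ)
    (hnoeth : ∀ I : ℕ → Subgroup H, (∀ n, (I n).Normal) →
      (∀ n, V φ (I (n + 1)) ⊆ V φ (I n)) → ∃ N : ℕ, ∀ n, N ≤ n → V φ (I n) = V φ (I N)) :
    ∃ s : Finset (Subgroup H), (∀ P ∈ s, IsPrimeIdeal φ P) ∧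
      sInf {P : Subgroup H | IsPrimeIdeal φ P} = sInf (s : Set (Subgroup H)) := by
  obtain ⟨s, hs, h⟩ := finite_decomp_aux φ hnoeth ⟨⊥, inferInstance⟩
  refine ⟨s, hs, ?_⟩
  rw [← h]
  simp [V]
end

section
/- Let G be a nontrivial group which, regarded as a G-group over itself via the identity map, has no divisors of zero. In the free product H = G ∗ ℤ, regarded as a G-group via the canonical inclusion of G, let t denote the generator of the ℤ-factor and, for each n ≥ 0, let Iₙ be the normal closure in H of t^(2ⁿ). Then each Iₙ is a prime ideal of H and I_{n+1} is strictly contained in Iₙ; in particular H has an infinite strictly descending chain of prime ideals, so the height of G ∗ ℤ is infinite. -/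
section Aux
universe u

/-- Two-element family of groups. -/
def Fam (G C : Type u) : Bool → Type u
  | true => G
  | false => C

instance famGroup (G C : Type u) [Group G] [Group C] : ∀ b, Group (Fam G C b)
  | true => inferInstanceAs (Group G)
  | false => inferInstanceAs (Group C)

open Monoid Monoid.CoprodI

variable {G C : Type u} [Group G] [Group C]

/-- inclusion of the first factor -/
def jG : G →* CoprodI (Fam G C) := (CoprodI.of (M := Fam G C) (i := true))

/-- inclusion of the second factor -/
def jC : C →* CoprodI (Fam G C) := (CoprodI.of (M := Fam G C) (i := false))

/-- one-letter word -/
def sG (g : G) (hg : g ≠ 1) : NeWord (Fam G C) true true :=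
  NeWord.singleton (M := Fam G C) (i := true) g hg

theorem sG_prod (g : G) (hg : g ≠ 1) : (sG (C := C) g hg).prod = jG g := by
  simp only [sG, jG]
  exact NeWord.prod_singleton (M := Fam G C) (i := true) g hg

theorem head_unique {i j i' j' : Bool} (w : NeWord (Fam G C) i j) (w' : NeWord (Fam G C) i' j')
    (h : w.prod = w'.prod) : i = i' := by
  classical
  have h1 : w.toWord = w'.toWord := Word.equiv.symm.injective h
  have h2 : w.toList = w'.toList := congrArg Word.toList h1
  have h3 := w.toList_head?
  rw [h2, w'.toList_head?] at h3
  simp only [Option.some.injEq] at h3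
  exact (congrArg Sigma.fst h3).symm

theorem absorb {i : Bool} (w : NeWord (Fam G C) i false) (g : G) :
    ∃ j, ∃ w' : NeWord (Fam G C) i j, w'.prod = w.prod * jG g := by
  by_cases hg : g = 1
  · exact ⟨false, w, by simp [hg]⟩
  · exact ⟨true, NeWord.append w (by decide) (sG g hg), by rw [NeWord.append_prod, sG_prod]⟩

theorem head_ne (w : NeWord (Fam G C) true false) (w' : NeWord (Fam G C) false false) (g g' : G)
    (h : w.prod * jG g = w'.prod * jG g') : False := by
  obtain ⟨j, v, hv⟩ := absorb w g
  obtain ⟨j', v', hv'⟩ := absorb w' g'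
  have := head_unique v v' (by rw [hv, hv', h])
  exact absurd this (by decide)

theorem form_aux {i j : Bool} (w : NeWord (Fam G C) i j) :
    (∃ g : G, g ≠ 1 ∧ i = true ∧ j = true ∧ w.prod = jG g) ∨
    ∃ (g0 g1 : G) (v : NeWord (Fam G C) false false), (i = false ↔ g0 = 1) ∧ (j = false ↔ g1 = 1) ∧
      w.prod = jG g0 * v.prod * jG g1 := by
  induction w with
  | @singleton i x hx =>
    cases i with
    | true => exact Or.inl ⟨x, hx, rfl, rfl, sG_prod x hx⟩
    | false => exact Or.inr ⟨1, 1, NeWord.singleton x hx, by simp, by simp, by simp⟩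
  | @append i j k l w1 hne w2 ih1 ih2 =>
    rw [NeWord.append_prod]
    rcases ih1 with ⟨g, hg, rfl, rfl, e1⟩ | ⟨g0, g1, v, h0, h1, e1⟩ <;>
    rcases ih2 with ⟨g', hg', rfl, rfl, e2⟩ | ⟨g0', g1', v', h0', h1', e2⟩
    · exact absurd rfl hne
    · have : k = false := by simpa using hne
      have h0 : g0' = 1 := h0'.1 this
      exact Or.inr ⟨g, g1', v', by simpa using hg, h1', by rw [e1, e2, h0]; simp [mul_assoc]⟩
    · have : j = false := by simpa using hne
      have h1 : g1 = 1 := h1.1 this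
      exact Or.inr ⟨g0, g', v, h0, by simpa using hg', by rw [e1, e2, h1]; simp [mul_assoc]⟩
    · have hm : g1 * g0' ≠ 1 := by
        cases j <;> cases k <;> simp_all
      refine Or.inr ⟨g0, g1', ((v.append (by decide) (sG (g1 * g0') hm)).append (by decide) v'),
        h0, h1', ?_⟩
      rw [e1, e2, NeWord.append_prod, NeWord.append_prod, sG_prod, map_mul]
      simp only [mul_assoc]

theorem form (x : CoprodI (Fam G C)) :
    (∃ g : G, x = jG g) ∨
    ∃ (g0 g1 : G) (v : NeWord (Fam G C) false false), x = jG g0 * v.prod * jG g1 := by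
  classical
  by_cases hx : x = 1
  · exact Or.inl ⟨1, by simp [hx]⟩
  · obtain ⟨i, j, w, hw⟩ := NeWord.of_word (Word.equiv x) (by
      intro h
      apply hx
      rw [← Word.equiv.symm_apply_apply x, h]
      exact Word.prod_empty)
    have hp : w.prod = x := by
      rw [NeWord.prod, hw]; exact Word.equiv.symm_apply_apply x
    rcases form_aux w with ⟨g, _, _, _, e⟩ | ⟨g0, g1, v, _, _, e⟩
    · exact Or.inl ⟨g, by rw [← hp, e]⟩
    · exact Or.inr ⟨g0, g1, v, by rw [← hp, e]⟩

theorem jG_inj : Function.Injective (jG : G →* CoprodI (Fam G C)) :=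
  CoprodI.of_injective (M := Fam G C) true

theorem exists_fourth (hnc : ∃ x y : G, x * y ≠ y * x) (a b : G) : ∃ h : G, h ≠ 1 ∧ h ≠ a ∧ h ≠ b := by
  obtain ⟨x, y, hxy⟩ := hnc
  by_contra! H
  have h1 : x ≠ 1 := by rintro rfl; simp at hxy
  have h2 : y ≠ 1 := by rintro rfl; simp at hxy
  have h3 : x * y ≠ 1 := by
    intro h
    have : y = x⁻¹ := (inv_eq_of_mul_eq_one_right h).symm
    subst this; simp at hxy
  have h4 : x ≠ y := by rintro rfl; simp at hxy
  have h5 : x * y ≠ x := by simpa using h2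
  have h6 : x * y ≠ y := by simpa using h1
  by_cases hxa : x = a
  · have hy : y = b := H y h2 (fun e => h4 (hxa.trans e.symm))
    exact h6 ((H _ h3 (fun e => h5 (e.trans hxa.symm))).trans hy.symm)
  · have hxb : x = b := H x h1 hxa
    by_cases hya : y = a
    · exact h5 ((H _ h3 (fun e => h6 (e.trans hya.symm))).trans hxb.symm)
    · exact h4 (hxb.trans (H y h2 hya).symm)

/-- mixed case -/
theorem mixed (x g0 g1 : G) (v : NeWord (Fam G C) false false)
    (h : ∀ g : G, Commute (jG (C := C) (g * x * g⁻¹)) (jG g0 * v.prod * jG g1)) : x = 1 := by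
  by_contra hx
  have h1 := (h g0).eq
  refine head_ne ((sG x hx).append (by decide) v) v g1 (g1 * g0 * x * g0⁻¹) ?_
  rw [NeWord.append_prod, sG_prod]
  have h2 := congrArg (fun z => (jG g0)⁻¹ * z) h1
  simpa [mul_assoc] using h2

theorem both (hnc : ∃ x y : G, x * y ≠ y * x) (a b a' b' : G) (v v' : NeWord (Fam G C) false false)
    (h : ∀ g g' : G, Commute (jG g * (jG a * v.prod * jG b) * (jG g)⁻¹)
      (jG g' * (jG a' * v'.prod * jG b') * (jG g')⁻¹)) : False := by
  obtain ⟨k, k1, k2, k3⟩ := exists_fourth hnc (b * a) (b' * a')⁻¹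
  have h1 := (h (k * a⁻¹) a'⁻¹).eq
  have m1 : b * a * k⁻¹ ≠ 1 := fun e => k2 (mul_inv_eq_one.1 e).symm
  have m2 : b' * a' * k ≠ 1 := fun e => k3 (eq_inv_of_mul_eq_one_right e)
  refine head_ne ((((sG k k1).append (by decide) v).append (by decide) (sG _ m1)).append
    (by decide) v') ((v'.append (by decide) (sG _ m2)).append (by decide) v) (b' * a')
    (b * a * k⁻¹) ?_
  simp only [NeWord.append_prod, sG_prod]
  simpa [mul_assoc] using h1

theorem commutator_bot_of_commute {A H : Type*} [Group A] [Group H] (φ : A →* H) (x y : H)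
    (h : ∀ g g' : A, Commute (φ g * x * (φ g)⁻¹) (φ g' * y * (φ g')⁻¹)) :
    ⁅conjClosure φ x, conjClosure φ y⁆ = (⊥ : Subgroup H) := by
  rw [Subgroup.commutator_eq_bot_iff_le_centralizer]
  unfold conjClosure
  rw [Subgroup.centralizer_closure, Subgroup.closure_le]
  rintro _ ⟨g, rfl⟩
  simp only [SetLike.mem_coe, Subgroup.mem_centralizer_iff]
  rintro _ ⟨g', rfl⟩
  exact (h g g').eq.symm

theorem noncomm_of_dom [Nontrivial G] (hdom : ∀ x : G, ¬ IsZeroDivisor (MonoidHom.id G) x) :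
    ∃ x y : G, x * y ≠ y * x := by
  by_contra! H
  obtain ⟨x, hx⟩ := exists_ne (1 : G)
  exact hdom x ⟨hx, x, hx, commutator_bot_of_commute _ _ _ fun g g' => H _ _⟩

theorem key [Nontrivial G] (hdom : ∀ x : G, ¬ IsZeroDivisor (MonoidHom.id G) x)
    (x y : CoprodI (Fam G C))
    (h : ∀ g g' : G, Commute (jG g * x * (jG g)⁻¹) (jG g' * y * (jG g')⁻¹)) : x = 1 ∨ y = 1 := by
  rcases form x with ⟨a, rfl⟩ | ⟨a, b, v, rfl⟩ <;> rcases form y with ⟨a', rfl⟩ | ⟨a', b', v', rfl⟩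
  · by_contra! hc
    refine hdom a ⟨fun e => hc.1 (by simp [e]), a', fun e => hc.2 (by simp [e]),
      commutator_bot_of_commute _ _ _ fun g g' => ?_⟩
    apply jG_inj (C := C)
    simpa using (h g g').eq
  · left
    rw [mixed a a' b' v' fun g => by simpa using h g 1, map_one]
  · right
    rw [mixed a' a b v fun g => by simpa using (h 1 g).symm, map_one]
  · exact (both (noncomm_of_dom hdom) a b a' b' v v' h).elim

theorem exists_map (m : ℕ) : ∃ (C : Type u) (_ : Group C)
    (f : Coprod G (Multiplicative ℤ) →* CoprodI (Fam G C)),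
    (∀ g, f (Coprod.inl g) = jG g) ∧
    f.ker = Subgroup.normalClosure {(Coprod.inr (Multiplicative.ofAdd 1) :
      Coprod G (Multiplicative ℤ)) ^ m} := by
  let N : Subgroup (Multiplicative ℤ) := Subgroup.zpowers (Multiplicative.ofAdd 1 ^ m)
  let C : Type u := ULift.{u} (Multiplicative ℤ ⧸ N)
  let q : Multiplicative ℤ →* C := (MulEquiv.ulift.symm.toMonoidHom).comp (QuotientGroup.mk' N)
  let f : Coprod G (Multiplicative ℤ) →* CoprodI (Fam G C) := Coprod.lift jG (jC.comp q)
  refine ⟨C, inferInstance, f, fun g => by simp [f], le_antisymm ?_ ?_⟩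
  · set I := Subgroup.normalClosure {(Coprod.inr (Multiplicative.ofAdd 1) :
      Coprod G (Multiplicative ℤ)) ^ m} with hI
    let r0 : Multiplicative ℤ →* Coprod G (Multiplicative ℤ) ⧸ I :=
      (QuotientGroup.mk' I).comp Coprod.inr
    have hr0 : N ≤ r0.ker := by
      rw [Subgroup.zpowers_le, MonoidHom.mem_ker]
      simp only [r0, MonoidHom.comp_apply, QuotientGroup.mk'_apply, map_pow]
      rw [← QuotientGroup.mk_pow, QuotientGroup.eq_one_iff]
      exact Subgroup.subset_normalClosure rfl
    let r : C →* Coprod G (Multiplicative ℤ) ⧸ I :=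
      (QuotientGroup.lift N r0 hr0).comp MulEquiv.ulift.toMonoidHom
    let F : ∀ b, Fam G C b →* Coprod G (Multiplicative ℤ) ⧸ I := fun b =>
      match b with
      | true => ((QuotientGroup.mk' I).comp Coprod.inl : G →* _)
      | false => r
    let s : CoprodI (Fam G C) →* Coprod G (Multiplicative ℤ) ⧸ I := CoprodI.lift F
    have hs : s.comp f = QuotientGroup.mk' I := by
      apply Coprod.hom_ext
      · ext g
        have : s (jG g) = F true g := CoprodI.lift_of (M := Fam G C) F (i := true) g
        simp only [MonoidHom.comp_apply, f, Coprod.lift_apply_inl, this]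
        rfl
      · apply MonoidHom.ext
        intro z
        have : s (jC (q z)) = F false (q z) := CoprodI.lift_of (M := Fam G C) F (i := false) (q z)
        simp only [MonoidHom.comp_apply, f, Coprod.lift_apply_inr, this]
        rfl
    intro x hx
    rw [MonoidHom.mem_ker] at hx
    have : QuotientGroup.mk' I x = 1 := by rw [← hs, MonoidHom.comp_apply, hx, map_one]
    simpa using this
  · apply Subgroup.normalClosure_le_normal
    rw [Set.singleton_subset_iff, SetLike.mem_coe, MonoidHom.mem_ker, ← map_pow]
    have : q (Multiplicative.ofAdd 1 ^ m) = 1 := by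
      have h1 : QuotientGroup.mk' N (Multiplicative.ofAdd 1 ^ m) = 1 :=
        (QuotientGroup.eq_one_iff _).2 (Subgroup.mem_zpowers _)
      simp only [q, MonoidHom.comp_apply, h1, map_one]
    simp only [f, Coprod.lift_apply_inr, MonoidHom.comp_apply, this, map_one]

end Aux

open Monoid in
/-- If the nontrivial group `G` (as a `G`-group over itself) has no divisors of zero,
then in `G ∗ ℤ` the normal closures `Iₙ` of `t^(2ⁿ)` form an infinite strictly
descending chain of prime ideals; so the height of `G ∗ ℤ` is infinite. -/
theorem statement16 (G : Type*) [Group G] [Nontrivial G]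
    (hdom : ∀ x : G, ¬ IsZeroDivisor (MonoidHom.id G) x) :
    let t : Coprod G (Multiplicative ℤ) := Coprod.inr (Multiplicative.ofAdd 1)
    let I : ℕ → Subgroup (Coprod G (Multiplicative ℤ)) :=
      fun n => Subgroup.normalClosure {t ^ (2 ^ n : ℕ)}
    (∀ n : ℕ, IsPrimeIdeal (Coprod.inl : G →* Coprod G (Multiplicative ℤ)) (I n)) ∧
      ∀ n : ℕ, I (n + 1) < I n := by
  intro t I
  have hfst : ∀ n, I n ≤ (Coprod.fst : Coprod G (Multiplicative ℤ) →* G).ker := by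
    intro n
    apply Subgroup.normalClosure_le_normal
    rw [Set.singleton_subset_iff, SetLike.mem_coe, MonoidHom.mem_ker]
    simp [t]
  refine ⟨fun n => ⟨⟨Subgroup.normalClosure_normal, ?_⟩, ?_, ?_⟩, fun n => ?_⟩
  · rw [eq_bot_iff]
    rintro _ ⟨hx, g, rfl⟩
    have h1 := hfst n hx
    rw [MonoidHom.mem_ker, Coprod.fst_apply_inl] at h1
    simp [h1]
  · intro htop
    obtain ⟨g, hg⟩ := exists_ne (1 : G)
    have h1 : (Coprod.inl g : Coprod G (Multiplicative ℤ)) ∈ I n := by rw [htop]; trivial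
    have h2 := hfst n h1
    rw [MonoidHom.mem_ker, Coprod.fst_apply_inl] at h2
    exact hg h2
  · intro x y
    have hN : (I n).Normal := Subgroup.normalClosure_normal
    have hcl : ∀ z ∈ I n, conjClosure (Coprod.inl : G →* Coprod G (Multiplicative ℤ)) z ≤ I n := by
      intro z hz
      unfold conjClosure
      rw [Subgroup.closure_le]
      rintro _ ⟨g, rfl⟩
      exact hN.conj_mem z hz _
    constructor
    · intro h
      obtain ⟨C, _, f, hf, hk⟩ := exists_map (G := G) (2 ^ n)
      have hk' : f.ker = I n := hk
      rw [← hk'] at h ⊢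
      simp only [MonoidHom.mem_ker]
      apply key hdom
      intro g g'
      have h1 := h (Subgroup.commutator_mem_commutator
        (Subgroup.subset_closure ⟨g, rfl⟩) (Subgroup.subset_closure ⟨g', rfl⟩))
      rw [MonoidHom.mem_ker, map_commutatorElement, commutatorElement_eq_one_iff_commute] at h1
      simpa [hf] using h1
    · rintro (h | h)
      · exact (Subgroup.commutator_mono (hcl x h) le_rfl).trans (Subgroup.commutator_le_left _ _ |>.trans le_rfl)
      · exact (Subgroup.commutator_mono le_rfl (hcl y h)).trans (Subgroup.commutator_le_right _ _)
  · refine lt_of_le_of_ne ?_ ?_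
    · apply Subgroup.normalClosure_le_normal
      have hm : t ^ (2 ^ n) ∈ I n := Subgroup.subset_normalClosure (Set.mem_singleton _)
      have e : t ^ (2 ^ (n + 1)) = (t ^ (2 ^ n)) ^ 2 := by rw [← pow_mul, ← pow_succ 2 n]
      rw [Set.singleton_subset_iff, SetLike.mem_coe, e]
      exact Subgroup.pow_mem _ hm _
    · intro he
      have h1 : t ^ (2 ^ n) ∈ I (n + 1) := by
        rw [he]; exact Subgroup.subset_normalClosure (Set.mem_singleton _)
      have h2 : I (n + 1) ≤ (Subgroup.zpowers (Multiplicative.ofAdd (1 : ℤ) ^ (2 ^ (n + 1)))).comap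
          (Coprod.snd : Coprod G (Multiplicative ℤ) →* Multiplicative ℤ) := by
        apply Subgroup.normalClosure_le_normal
        rw [Set.singleton_subset_iff, SetLike.mem_coe, Subgroup.mem_comap, map_pow]
        simp only [t, Coprod.snd_apply_inr]
        exact Subgroup.mem_zpowers _
      have h3 := h2 h1
      rw [Subgroup.mem_comap, map_pow] at h3
      simp only [t, Coprod.snd_apply_inr] at h3
      obtain ⟨k, hk⟩ := Subgroup.mem_zpowers_iff.1 h3
      have h4 := congrArg Multiplicative.toAdd hk
      simp only [toAdd_zpow, toAdd_pow, toAdd_ofAdd, smul_eq_mul, nsmul_eq_mul, mul_one] at h4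
      push_cast at h4
      have h5 : (2 : ℤ) ^ n ≠ 0 := by positivity
      have h6 : k * 2 = 1 := by
        apply mul_right_cancel₀ h5
        rw [one_mul]; refine Eq.trans ?_ h4; ring
      omega
end

section
/- Let G be a nonabelian simple group and n ≥ 1, and let H = Gⁿ be the direct product of n copies of G, regarded as a G-group via the embedding g ↦ (g, 1, …, 1) into the first factor. Then H has exactly one prime ideal, namely P₀ = {(g₁, …, gₙ) ∈ Gⁿ : g₁ = 1}. -/
theorem map_conjClosure_aux_s17 {G H : Type*} [Group G] [Group H] [IsSimpleGroup G] (φ : G →* H)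
    (e : H →* G) (he : ∀ g, e (φ g) = g) (x : H) (hx : e x ≠ 1) :
    (conjClosure φ x).map e = ⊤ := by
  have h1 : Subgroup.normalClosure {e x} ≤ (conjClosure φ x).map e := by
    unfold Subgroup.normalClosure
    rw [Subgroup.closure_le]
    intro z hz
    rw [Group.mem_conjugatesOfSet_iff] at hz
    obtain ⟨a, ha, hz⟩ := hz
    rw [Set.mem_singleton_iff] at ha
    subst ha
    obtain ⟨c, hc⟩ := isConj_iff.1 hz
    refine ⟨φ c * x * (φ c)⁻¹, Subgroup.subset_closure ⟨c, rfl⟩, ?_⟩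
    simp [he, hc]
  have h2 : Subgroup.normalClosure {e x} = ⊤ := by
    rcases (Subgroup.normalClosure_normal (s := {e x})).eq_bot_or_eq_top with h | h
    · exfalso
      apply hx
      have : e x ∈ Subgroup.normalClosure {e x} := Subgroup.subset_normalClosure rfl
      rw [h] at this
      simpa using this
    · exact h
  rw [h2] at h1
  exact top_le_iff.1 h1

theorem conjClosure_le_aux {G H : Type*} [Group G] [Group H] (φ : G →* H) (P : Subgroup H)
    (hP : P.Normal) (x : H) (hx : x ∈ P) : conjClosure φ x ≤ P := by
  unfold conjClosure
  rw [Subgroup.closure_le]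
  rintro z ⟨g, rfl⟩
  exact hP.conj_mem x hx _

theorem center_aux {G : Type*} [Group G] [IsSimpleGroup G]
    (hna : ∃ a b : G, a * b ≠ b * a) : Subgroup.center G = ⊥ := by
  rcases (inferInstance : (Subgroup.center G).Normal).eq_bot_or_eq_top with h | h
  · exact h
  · obtain ⟨a, b, hab⟩ := hna
    have : b ∈ Subgroup.center G := by rw [h]; trivial
    exact absurd (Subgroup.mem_center_iff.1 this a) hab

/-- For a nonabelian simple group `G` and `n ≥ 1`, the `G`-group `Gⁿ` (via the first
factor embedding) has exactly one prime ideal, the kernel of the first projection. -/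
theorem statement17 (G : Type*) [Group G] [IsSimpleGroup G]
    (hna : ∃ a b : G, a * b ≠ b * a) (n : ℕ) (hn : 1 ≤ n) :
    {P : Subgroup (Fin n → G) |
        IsPrimeIdeal (MonoidHom.mulSingle (fun _ : Fin n => G) (⟨0, hn⟩ : Fin n)) P} =
      {(Pi.evalMonoidHom (fun _ : Fin n => G) (⟨0, hn⟩ : Fin n)).ker} := by
  set i : Fin n := ⟨0, hn⟩ with hi
  set φ := MonoidHom.mulSingle (fun _ : Fin n => G) i with hφ
  set e := Pi.evalMonoidHom (fun _ : Fin n => G) i with hE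
  have he : ∀ g, e (φ g) = g := fun g => by simp [hE, hφ]
  have hcomm : ∀ x ∈ e.ker, ∀ g, φ g * x = x * φ g := by
    intro x hx g
    have hx : x i = 1 := hx
    funext j
    by_cases hj : j = i
    · rw [hj]; simp [hφ, hx]
    · simp [hφ, Pi.mulSingle_eq_of_ne hj]
  ext P
  simp only [Set.mem_ofPred_eq, Set.mem_singleton_iff]
  constructor
  · rintro ⟨⟨hN, hI⟩, -, hp⟩
    have hI' : ∀ g, φ g ∈ P → g = 1 := by
      intro g hg
      have : φ g ∈ P ⊓ φ.range := ⟨hg, g, rfl⟩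
      rw [hI, Subgroup.mem_bot] at this
      rw [← he g, this, map_one]
    apply le_antisymm
    · intro x hx
      rw [MonoidHom.mem_ker, ← Subgroup.mem_bot, ← center_aux hna, Subgroup.mem_center_iff]
      intro g
      have h1 : φ (g * e x * g⁻¹ * (e x)⁻¹) = φ g * x * (φ g)⁻¹ * x⁻¹ := by
        funext j
        by_cases hj : j = i
        · rw [hj]; simp [hφ, hE]
        · simp [hφ, Pi.mulSingle_eq_of_ne hj]
      have h2 : φ (g * e x * g⁻¹ * (e x)⁻¹) ∈ P := by
        rw [h1]
        exact P.mul_mem (hN.conj_mem x hx _) (P.inv_mem hx)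
      have h3 := hI' _ h2
      rwa [mul_inv_eq_one, mul_inv_eq_iff_eq_mul] at h3
    · intro x hx
      obtain ⟨g, hg⟩ := exists_ne (1 : G)
      have hc : ⁅conjClosure φ x, conjClosure φ (φ g)⁆ ≤ P := by
        rw [Subgroup.commutator_le]
        intro a ha b hb
        have ha' : a ∈ e.ker := conjClosure_le_aux φ _ (MonoidHom.normal_ker e) x hx ha
        have hb' : b ∈ φ.range := by
          revert hb
          apply (Subgroup.closure_le _).2
          rintro z ⟨c, rfl⟩
          exact ⟨c * g * c⁻¹, by simp⟩
        obtain ⟨c, rfl⟩ := hb'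
        rw [commutatorElement_eq_one_iff_mul_comm.2 (hcomm a ha' c).symm]
        exact P.one_mem
      rcases (hp _ _).1 hc with h | h
      · exact h
      · exact absurd (hI' g h) hg
  · rintro rfl
    refine ⟨⟨MonoidHom.normal_ker e, ?_⟩, ?_, ?_⟩
    · rw [eq_bot_iff]
      rintro _ ⟨h1, g, rfl⟩
      have h1 : e (φ g) = 1 := h1
      rw [he] at h1
      simp [h1]
    · intro h
      obtain ⟨g, hg⟩ := exists_ne (1 : G)
      have : φ g ∈ e.ker := by rw [h]; trivial
      rw [MonoidHom.mem_ker, he] at this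
      exact hg this
    · intro x y
      have hN := MonoidHom.normal_ker e
      constructor
      · intro h
        by_contra hcon
        push Not at hcon
        obtain ⟨hx, hy⟩ := hcon
        have hm := Subgroup.map_commutator (conjClosure φ x) (conjClosure φ y) e
        rw [map_conjClosure_aux_s17 φ e he x hx, map_conjClosure_aux_s17 φ e he y hy,
          (Subgroup.map_eq_bot_iff _).2 h] at hm
        obtain ⟨a, b, hab⟩ := hna
        have := Subgroup.commutator_mem_commutator (Subgroup.mem_top a) (Subgroup.mem_top b)
        rw [← hm] at this
        exact hab (commutatorElement_eq_one_iff_mul_comm.1 (Subgroup.mem_bot.1 this))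
      · rintro (h | h)
        · exact (Subgroup.commutator_mono (conjClosure_le_aux φ _ hN x h) le_top).trans
            (Subgroup.commutator_le_left _ _)
        · exact (Subgroup.commutator_mono le_top (conjClosure_le_aux φ _ hN y h)).trans
            (Subgroup.commutator_le_right _ _)
end

section
/- Let H be a G-group without divisors of zero (a G-domain) such that φ(G) is a normal subgroup of H, and let P be a prime ideal of H which is a G-point, i.e. every element h ∈ H can be written h = p·φ(g) with p ∈ P and g ∈ G. Then the map P × G → H sending (p, g) to p·φ(g) is a group isomorphism; in particular H is the internal direct product of P and φ(G). -/
/-- If the `G`-domain `H` has `φ(G)` normal and `P` is a prime ideal which is a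
`G`-point, then `(p, g) ↦ p · φ g` is a group isomorphism `P × G ≃ H`. -/
theorem statement18 {G H : Type*} [Group G] [Group H] (φ : G →* H)
    (hφ : Function.Injective φ) (hdom : ∀ x : H, ¬ IsZeroDivisor φ x)
    (hrange : (φ.range).Normal) (P : Subgroup H) (hP : IsPrimeIdeal φ P)
    (hpt : ∀ h : H, ∃ p ∈ P, ∃ g : G, h = p * φ g) :
    (∀ a b : P × G, ((a * b).1 : H) * φ (a * b).2 =
        (((a.1 : H) * φ a.2) * ((b.1 : H) * φ b.2))) ∧
      Function.Bijective (fun pg : P × G => ((pg.1 : H) * φ pg.2)) := by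
  obtain ⟨⟨hN, hI⟩, -, -⟩ := hP
  have hdisj : Disjoint P φ.range := disjoint_iff.mpr hI
  have hcomm : ∀ p ∈ P, ∀ g : G, p * φ g = φ g * p := fun p hp g =>
    Subgroup.commute_of_normal_of_disjoint P φ.range hN hrange hdisj p (φ g) hp ⟨g, rfl⟩
  refine ⟨?_, ?_, ?_⟩
  · rintro ⟨⟨p, hp⟩, g⟩ ⟨⟨q, hq⟩, k⟩
    change p * q * φ (g * k) = p * φ g * (q * φ k)
    rw [map_mul, mul_assoc p q, ← mul_assoc q, hcomm q hq g]
    simp only [mul_assoc]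
  · rintro ⟨⟨p, hp⟩, g⟩ ⟨⟨q, hq⟩, k⟩ h
    change p * φ g = q * φ k at h
    have h1 : q⁻¹ * p = φ (k * g⁻¹) := by
      rw [map_mul, map_inv, eq_mul_inv_iff_mul_eq, mul_assoc, h, inv_mul_cancel_left]
    have h2 : q⁻¹ * p = 1 := by
      have : q⁻¹ * p ∈ P ⊓ φ.range :=
        ⟨P.mul_mem (P.inv_mem hq) hp, ⟨k * g⁻¹, h1.symm⟩⟩
      rw [hI] at this
      exact Subgroup.mem_bot.mp this
    have h3 : q = p := inv_mul_eq_one.mp h2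
    subst h3
    have h4 : g = k := hφ (mul_left_cancel h)
    subst h4
    rfl
  · intro h
    obtain ⟨p, hp, g, e⟩ := hpt h
    exact ⟨(⟨p, hp⟩, g), e.symm⟩
end

section
/- Let H be an algebraic extension of G. Then for every n ≥ 1 there is no surjective G-morphism from H onto G[x₁, …, xₙ] = G ∗ Fₙ; that is, the G-co-rank of H is strictly less than 1. -/
open Monoid in
/-- An algebraic extension `H` of `G` admits no surjective `G`-morphism onto
`G[x₁, …, xₙ] = G ∗ Fₙ` for any `n ≥ 1`: its `G`-co-rank is strictly less than `1`. -/
theorem statement19 {G H : Type*} [Group G] [Group H] (φ : G →* H)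
    (hφ : Function.Injective φ)
    (halg : ∀ a : H, ∃ w : Coprod G (Multiplicative ℤ),
      w ∉ (Coprod.inl : G →* Coprod G (Multiplicative ℤ)).range ∧
        Coprod.lift φ (zpowersHom H a) w = 1) :
    ∀ n : ℕ, 1 ≤ n →
      ¬ ∃ s : H →* Coprod G (FreeGroup (Fin n)),
          s.comp φ = (Coprod.inl : G →* Coprod G (FreeGroup (Fin n))) ∧
            Function.Surjective s := by
  rintro n hn ⟨s, hs, hsurj⟩
  obtain ⟨a, ha⟩ := hsurj (Coprod.inr (FreeGroup.of ⟨0, hn⟩))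
  obtain ⟨w, hw, hw1⟩ := halg a
  let p : Coprod G (FreeGroup (Fin n)) →* Coprod G (Multiplicative ℤ) :=
    Coprod.lift Coprod.inl
      (FreeGroup.lift fun _ => Coprod.inr (Multiplicative.ofAdd (1 : ℤ)))
  have key : (p.comp s).comp (Coprod.lift φ (zpowersHom H a)) = MonoidHom.id _ := by
    apply Coprod.hom_ext
    · ext g
      have h := DFunLike.congr_fun hs g
      simp only [MonoidHom.comp_apply] at h
      simp [h, p]
    · apply MonoidHom.ext_mint
      simp [ha, p]
  have h := DFunLike.congr_fun key w
  simp only [MonoidHom.comp_apply, hw1, map_one, MonoidHom.id_apply] at h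
  exact hw (h ▸ one_mem _)
end
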